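/- arXiv:1511.01310 — 5 statements merged into one kernel-verified Lean document; each statement's English description precedes it below -/
import Mathlib

section
/- Let a, b ∈ ℂ, let U ⊆ ℂ be open, and let y : U → ℂ be holomorphic with θ²y = z·(θ+a)(θ+b)y on U, where θg(z) = z·g'(z). Then for every natural number m, the function g(z) = z^m·y^{(m)}(z) (the m-th complex derivative of y multiplied by z^m) satisfies θ²g − m·θg = z·(θ+a)(θ+b)g on U. -/
/-- `θg(z) = z·g'(z)` for functions of one complex variable. -/
noncomputable def thFun (g : ℂ → ℂ) : ℂ → ℂ := fun z => z * deriv g z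

/-- `(θ+c)g = θg + c·g`. -/
noncomputable def shiftFun (c : ℂ) (g : ℂ → ℂ) : ℂ → ℂ := fun z => thFun g z + c * g z

open Filter Topology

theorem thFun_pow_mul {f : ℂ → ℂ} {f' z : ℂ} (m : ℕ) (hf : HasDerivAt f f' z) :
    thFun (fun w => w ^ m * f w) z = z ^ m * (z * f' + m * f z) := by
  rw [thFun, ((hasDerivAt_pow m z).fun_mul hf).deriv]
  cases m with
  | zero => simp
  | succ k => simp only [Nat.add_sub_cancel]; ring

theorem shiftFun_pow_mul {f : ℂ → ℂ} {f' z : ℂ} (c : ℂ) (m : ℕ) (hf : HasDerivAt f f' z) :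
    shiftFun c (fun w => w ^ m * f w) z = z ^ m * (z * f' + (m + c) * f z) := by
  rw [shiftFun, thFun_pow_mul m hf]
  ring

theorem thFun_congr {f g : ℂ → ℂ} {z : ℂ} (h : f =ᶠ[𝓝 z] g) : thFun f z = thFun g z := by
  rw [thFun, thFun, h.deriv_eq]

theorem shiftFun_congr {f g : ℂ → ℂ} {z : ℂ} (c : ℂ) (h : f =ᶠ[𝓝 z] g) :
    shiftFun c f z = shiftFun c g z := by
  rw [shiftFun, shiftFun, thFun_congr h, h.eq_of_nhds]

theorem thFun_thFun_pow_mul {f f' : ℂ → ℂ} {f'' z : ℂ} (m : ℕ)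
    (hf : ∀ᶠ w in 𝓝 z, HasDerivAt f (f' w) w) (hf' : HasDerivAt f' f'' z) :
    thFun (thFun (fun w => w ^ m * f w)) z =
      z ^ m * (z ^ 2 * f'' + (2 * m + 1) * z * f' z + m ^ 2 * f z) := by
  rw [thFun_congr (hf.mono fun w hw => thFun_pow_mul m hw),
    thFun_pow_mul m (((hasDerivAt_id' z).fun_mul hf').fun_add (hf.self_of_nhds.const_mul (m : ℂ)))]
  ring

theorem shiftFun_shiftFun_pow_mul {f f' : ℂ → ℂ} {f'' z : ℂ} (a b : ℂ) (m : ℕ)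
    (hf : ∀ᶠ w in 𝓝 z, HasDerivAt f (f' w) w) (hf' : HasDerivAt f' f'' z) :
    shiftFun a (shiftFun b (fun w => w ^ m * f w)) z =
      z ^ m * (z ^ 2 * f'' + (2 * m + 1 + a + b) * z * f' z + (m + a) * (m + b) * f z) := by
  rw [shiftFun_congr a (hf.mono fun w hw => shiftFun_pow_mul b m hw),
    shiftFun_pow_mul a m (((hasDerivAt_id' z).fun_mul hf').fun_add (hf.self_of_nhds.const_mul (m + b)))]
  ring

theorem DifferentiableOn.hasDerivAt_iteratedDeriv {U : Set ℂ} (hU : IsOpen U) {y : ℂ → ℂ}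
    (hy : DifferentiableOn ℂ y U) (k : ℕ) {z : ℂ} (hz : z ∈ U) :
    HasDerivAt (iteratedDeriv k y) (iteratedDeriv (k + 1) y z) z := by
  rw [iteratedDeriv_succ]
  refine DifferentiableAt.hasDerivAt ?_
  rw [iteratedDeriv_eq_iterate]
  exact ((hy.analyticAt (hU.mem_nhds hz)).iterated_deriv k).differentiableAt

/-- The derivatives of a solution of a hypergeometric equation with third parameter `1` satisfy
the hypergeometric equations with shifted parameters. -/
theorem hypergeometric_iteratedDeriv {a b : ℂ} {V : Set ℂ} (hV : IsOpen V) {y : ℂ → ℂ}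
    (hy : DifferentiableOn ℂ y V)
    (h : ∀ z ∈ V, z * (1 - z) * iteratedDeriv 2 y z
      + (1 - (1 + a + b) * z) * iteratedDeriv 1 y z - a * b * iteratedDeriv 0 y z = 0) (m : ℕ) :
    ∀ z ∈ V, z * (1 - z) * iteratedDeriv (m + 2) y z
      + (m + 1 - (2 * m + 1 + a + b) * z) * iteratedDeriv (m + 1) y z
      - (m + a) * (m + b) * iteratedDeriv m y z = 0 := by
  induction m with
  | zero => simpa using h
  | succ m ih =>
    intro z hz
    have hD (k : ℕ) := hy.hasDerivAt_iteratedDeriv hV k hz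
    have hid := hasDerivAt_id' z
    have key := (((hid.mul (hid.const_sub 1)).mul (hD (m + 2))).add
      (((hid.const_mul (2 * m + 1 + a + b)).const_sub (m + 1 : ℂ)).mul (hD (m + 1)))).sub
      ((hD m).const_mul ((m + a) * (m + b)))
    have hzero := key.unique ((hasDerivAt_const z (0 : ℂ)).congr_of_eventuallyEq
      (eventually_of_mem (hV.mem_nhds hz) ih))
    simp only [Pi.mul_apply] at hzero
    push_cast
    rw [← hzero]
    ring

/-- If `y` is holomorphic on the open set `U` and satisfies `θ²y = z·(θ+a)(θ+b)y` on `U`,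
then for every `m`, the function `g(z) = z^m·y^{(m)}(z)` satisfies
`θ²g − m·θg = z·(θ+a)(θ+b)g` on `U`. -/
theorem statement6 (a b : ℂ) (U : Set ℂ) (hU : IsOpen U) (y : ℂ → ℂ)
    (hy : DifferentiableOn ℂ y U)
    (heq : ∀ z ∈ U, thFun (thFun y) z = z * shiftFun a (shiftFun b y) z) (m : ℕ) :
    ∀ z ∈ U,
      thFun (thFun (fun w => w ^ m * iteratedDeriv m y w)) z
          - (m : ℂ) * thFun (fun w => w ^ m * iteratedDeriv m y w) z
        = z * shiftFun a (shiftFun b (fun w => w ^ m * iteratedDeriv m y w)) z := by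
  have hD (k : ℕ) {z : ℂ} (hz : z ∈ U) := hy.hasDerivAt_iteratedDeriv hU k hz
  have hev (k : ℕ) {z : ℂ} (hz : z ∈ U) :
      ∀ᶠ w in 𝓝 z, HasDerivAt (iteratedDeriv k y) (iteratedDeriv (k + 1) y w) w :=
    eventually_of_mem (hU.mem_nhds hz) fun w hw => hD k hw
  have base : ∀ z ∈ U \ {0}, z * (1 - z) * iteratedDeriv 2 y z
      + (1 - (1 + a + b) * z) * iteratedDeriv 1 y z - a * b * iteratedDeriv 0 y z = 0 := by
    rintro z ⟨hz, hz0⟩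
    have h1 := thFun_thFun_pow_mul 0 (hev 0 hz) (hD 1 hz)
    have h2 := shiftFun_shiftFun_pow_mul a b 0 (hev 0 hz) (hD 1 hz)
    simp only [pow_zero, one_mul, iteratedDeriv_zero] at h1 h2 ⊢
    have h3 := heq z hz
    rw [h1, h2] at h3
    refine mul_left_cancel₀ (show z ≠ 0 from hz0) ?_
    push_cast at h3
    linear_combination h3
  intro z hz
  rcases eq_or_ne z 0 with rfl | hz0
  · simp [thFun]
  have h := hypergeometric_iteratedDeriv (hU.sdiff isClosed_singleton)
    (hy.mono Set.sdiff_subset) base m z ⟨hz, hz0⟩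
  rw [thFun_thFun_pow_mul m (hev m hz) (hD (m + 1) hz), thFun_pow_mul m (hD m hz),
    shiftFun_shiftFun_pow_mul a b m (hev m hz) (hD (m + 1) hz)]
  linear_combination z ^ (m + 1) * h
end

section
/- Let a0, a1, a2, m ∈ ℂ and let U ⊆ ℂ be open. Suppose y1, y2 : U → ℂ are holomorphic and both satisfy θ²y − m·θy − a0·z·(θ+a1)(θ+a2)y = 0 on U, where θg(z) = z·g'(z). Define the Wronskian W(z) = y1(z)·θy2(z) − y2(z)·θy1(z). Then (1 − a0·z)·θW(z) = (a0·(a1+a2)·z + m)·W(z) for all z ∈ U. -/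
theorem differentiableAt_thFun {U : Set ℂ} (hU : IsOpen U) {y : ℂ → ℂ}
    (hy : DifferentiableOn ℂ y U) {z : ℂ} (hz : z ∈ U) : DifferentiableAt ℂ (thFun y) z :=
  differentiableAt_id.mul ((hy.deriv hU).differentiableAt (hU.mem_nhds hz))

theorem thFun_mul {f g : ℂ → ℂ} {z : ℂ} (hf : DifferentiableAt ℂ f z)
    (hg : DifferentiableAt ℂ g z) :
    thFun (fun w => f w * g w) z = thFun f z * g z + f z * thFun g z := by
  simp only [thFun, deriv_fun_mul hf hg]
  ring

theorem thFun_sub {f g : ℂ → ℂ} {z : ℂ} (hf : DifferentiableAt ℂ f z)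
    (hg : DifferentiableAt ℂ g z) :
    thFun (fun w => f w - g w) z = thFun f z - thFun g z := by
  simp only [thFun, deriv_fun_sub hf hg]
  ring

theorem shiftFun_shiftFun (a b : ℂ) {y : ℂ → ℂ} {z : ℂ} (hy : DifferentiableAt ℂ y z)
    (hty : DifferentiableAt ℂ (thFun y) z) :
    shiftFun a (shiftFun b y) z = thFun (thFun y) z + (a + b) * thFun y z + a * b * y z := by
  have h : thFun (shiftFun b y) z = thFun (thFun y) z + b * thFun y z := by
    have hd : deriv (shiftFun b y) z = deriv (thFun y) z + b * deriv y z :=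
      (hty.hasDerivAt.add (hy.hasDerivAt.const_mul b)).deriv
    rw [thFun, hd]
    simp only [thFun]
    ring
  rw [shiftFun, h, shiftFun]
  ring

/-- If `y1, y2` are holomorphic on the open set `U` and both satisfy
`θ²y − m·θy − a0·z·(θ+a1)(θ+a2)y = 0` on `U`, then the Wronskian
`W = y1·θy2 − y2·θy1` satisfies `(1 − a0·z)·θW = (a0(a1+a2)z + m)·W` on `U`. -/
theorem statement7 (a0 a1 a2 m : ℂ) (U : Set ℂ) (hU : IsOpen U) (y1 y2 : ℂ → ℂ)
    (h1 : DifferentiableOn ℂ y1 U) (h2 : DifferentiableOn ℂ y2 U)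
    (he1 : ∀ z ∈ U,
      thFun (thFun y1) z - m * thFun y1 z - a0 * z * shiftFun a1 (shiftFun a2 y1) z = 0)
    (he2 : ∀ z ∈ U,
      thFun (thFun y2) z - m * thFun y2 z - a0 * z * shiftFun a1 (shiftFun a2 y2) z = 0) :
    ∀ z ∈ U,
      (1 - a0 * z) * thFun (fun w => y1 w * thFun y2 w - y2 w * thFun y1 w) z
        = (a0 * (a1 + a2) * z + m) * (y1 z * thFun y2 z - y2 z * thFun y1 z) := by
  intro z hz
  have d1 := h1.differentiableAt (hU.mem_nhds hz)
  have d2 := h2.differentiableAt (hU.mem_nhds hz)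
  have t1 := differentiableAt_thFun hU h1 hz
  have t2 := differentiableAt_thFun hU h2 hz
  have e1 := he1 z hz
  have e2 := he2 z hz
  rw [shiftFun_shiftFun a1 a2 d1 t1] at e1
  rw [shiftFun_shiftFun a1 a2 d2 t2] at e2
  rw [thFun_sub (d1.fun_mul t2) (d2.fun_mul t1), thFun_mul d1 t2, thFun_mul d2 t1]
  linear_combination y1 z * e2 - y2 z * e1
end

section
/- Let V be a complex normed vector space and B : V × V → ℂ a continuous symmetric ℂ-bilinear form. Let U ⊆ ℂ be open and Ω : U → V be C^∞ (infinitely complex-differentiable). Suppose that for every z ∈ U and every j with 0 ≤ j ≤ 3, B(Ω(z), Ω^{(j)}(z)) = 0, where Ω^{(j)} is the j-th derivative of Ω. Then for every z ∈ U: B(Ω(z), Ω^{(5)}(z)) = (5/2)·(d/dz)[w ↦ B(Ω(w), Ω^{(4)}(w))](z). -/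
theorem ContDiffAt.hasDerivAt_iteratedDeriv {𝕜 F : Type*} [NontriviallyNormedField 𝕜]
    [NormedAddCommGroup F] [NormedSpace 𝕜 F] {f : 𝕜 → F} {z : 𝕜}
    {n : WithTop ℕ∞} {m : ℕ} (hf : ContDiffAt 𝕜 n f z) (hmn : m < n) :
    HasDerivAt (iteratedDeriv m f) (iteratedDeriv (m + 1) f z) z := by
  have h : DifferentiableAt 𝕜 (iteratedDeriv m f) z := by
    rw [iteratedDeriv_eq_equiv_comp, LinearIsometryEquiv.comp_differentiableAt_iff]
    exact hf.differentiableAt_iteratedFDeriv hmn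
  rw [iteratedDeriv_succ]
  exact h.hasDerivAt

/-- The product rule for the pairing of two iterated derivatives of the same function. -/
theorem ContDiffOn.hasDerivAt_pairing_iteratedDeriv {𝕜 V G : Type*} [NontriviallyNormedField 𝕜]
    [NormedAddCommGroup V] [NormedSpace 𝕜 V] [NormedAddCommGroup G] [NormedSpace 𝕜 G]
    (B : V →L[𝕜] V →L[𝕜] G) {U : Set 𝕜} (hU : IsOpen U) {f : 𝕜 → V} (hf : ContDiffOn 𝕜 ⊤ f U)
    (i j : ℕ) {z : 𝕜} (hz : z ∈ U) :
    HasDerivAt (fun w => B (iteratedDeriv i f w) (iteratedDeriv j f w))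
      (B (iteratedDeriv (i + 1) f z) (iteratedDeriv j f z) +
        B (iteratedDeriv i f z) (iteratedDeriv (j + 1) f z)) z := by
  have hd (n : ℕ) : HasDerivAt (iteratedDeriv n f) (iteratedDeriv (n + 1) f z) z :=
    (hf.contDiffAt (hU.mem_nhds hz)).hasDerivAt_iteratedDeriv (WithTop.coe_lt_top _)
  exact (B.hasFDerivAt.comp_hasDerivAt z (hd i)).clm_apply (hd j)

theorem HasDerivAt.unique_of_eqOn_isOpen {𝕜 F : Type*} [NontriviallyNormedField 𝕜]
    [NormedAddCommGroup F] [NormedSpace 𝕜 F] {f g : 𝕜 → F} {f' g' : F} {U : Set 𝕜} {z : 𝕜}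
    (hf : HasDerivAt f f' z) (hg : HasDerivAt g g' z) (hU : IsOpen U) (hz : z ∈ U)
    (h : Set.EqOn f g U) : f' = g' :=
  hf.unique (hg.congr_of_eventuallyEq (h.eventuallyEq_of_mem (hU.mem_nhds hz)))

/-- Griffiths transversality relation `W^{(5)} = (5/2)·(W^{(4)})'`:
if `B(Ω, Ω^{(j)}) = 0` on `U` for `0 ≤ j ≤ 3`, then
`B(Ω, Ω^{(5)}) = (5/2)·(d/dz) B(Ω, Ω^{(4)})` on `U`. -/
theorem statement12 {V : Type*} [NormedAddCommGroup V] [NormedSpace ℂ V]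
    (B : V →L[ℂ] V →L[ℂ] ℂ) (hB : ∀ u v : V, B u v = B v u)
    (U : Set ℂ) (hU : IsOpen U) (Ω : ℂ → V) (hΩ : ContDiffOn ℂ ⊤ Ω U)
    (h0 : ∀ z ∈ U, ∀ j : ℕ, j ≤ 3 → B (Ω z) (iteratedDeriv j Ω z) = 0) :
    ∀ z ∈ U,
      B (Ω z) (iteratedDeriv 5 Ω z)
        = (5 / 2) * deriv (fun w => B (Ω w) (iteratedDeriv 4 Ω w)) z := by
  set W : ℕ → ℕ → ℂ → ℂ := fun i j w => B (iteratedDeriv i Ω w) (iteratedDeriv j Ω w) with hW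
  have symm (i j : ℕ) (z : ℂ) : W i j z = W j i z := hB _ _
  have hd (i j : ℕ) {z : ℂ} (hz : z ∈ U) :
      HasDerivAt (W i j) (W (i + 1) j z + W i (j + 1) z) z :=
    hΩ.hasDerivAt_pairing_iteratedDeriv B hU i j hz
  have hzero (j : ℕ) (hj : j ≤ 3) : Set.EqOn (W 0 j) (fun _ => 0) U := fun z hz => by
    simpa [hW] using h0 z hz j hj
  have h12 : Set.EqOn (W 1 2) (fun _ => 0) U := fun z hz => by
    have h := (hd 0 2 hz).unique_of_eqOn_isOpen (hasDerivAt_const z 0) hU hz (hzero 2 (by simp))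
    linear_combination h - hzero 3 (by simp) hz
  have h13 : Set.EqOn (W 1 3) (-W 0 4) U := fun z hz => by
    have h := (hd 0 3 hz).unique_of_eqOn_isOpen (hasDerivAt_const z 0) hU hz (hzero 3 le_rfl)
    simp only [Pi.neg_apply]
    linear_combination h
  have h22 : Set.EqOn (W 2 2) (W 0 4) U := fun z hz => by
    have h := (hd 1 2 hz).unique_of_eqOn_isOpen (hasDerivAt_const z 0) hU hz h12
    have h' := h13 hz
    simp only [Pi.neg_apply] at h'
    linear_combination h - h'
  intro z hz
  have e13 := (hd 1 3 hz).unique_of_eqOn_isOpen (hd 0 4 hz).neg hU hz h13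
  have e22 := (hd 2 2 hz).unique_of_eqOn_isOpen (hd 0 4 hz) hU hz h22
  have e04 := (hd 0 4 hz).deriv
  simp only [Nat.reduceAdd, zero_add] at e13 e22 e04
  have e32 := symm 3 2 z
  have key : W 0 5 z = 5 / 2 * deriv (W 0 4) z := by
    rw [e04]
    linear_combination -e13 + (1 / 2) * e22 - (1 / 2) * e32
  simpa only [hW, iteratedDeriv_zero] using key
end

section
/- Let V be a complex normed vector space and B : V × V → ℂ a continuous symmetric ℂ-bilinear form. Let U ⊆ ℂ² be open and Ω : U → V be C^∞. Suppose that for all (i,j) with i + j ≤ 3 one has B(Ω, ∂₁^i∂₂^j Ω) = 0 identically on U, where ∂₁, ∂₂ are the partial derivatives in the two coordinates. Then on U: B(Ω, ∂₁⁴∂₂ Ω) = (1/2)·( ∂₂[B(Ω, ∂₁⁴Ω)] + 4·∂₁[B(Ω, ∂₁³∂₂Ω)] ). -/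
/-- Partial derivative in the first coordinate of a function on `ℂ²`. -/
noncomputable def pd1 {V : Type*} [NormedAddCommGroup V] [NormedSpace ℂ V]
    (f : ℂ × ℂ → V) : ℂ × ℂ → V :=
  fun p => deriv (fun w => f (w, p.2)) p.1

/-- Partial derivative in the second coordinate of a function on `ℂ²`. -/
noncomputable def pd2 {V : Type*} [NormedAddCommGroup V] [NormedSpace ℂ V]
    (f : ℂ × ℂ → V) : ℂ × ℂ → V :=
  fun p => deriv (fun w => f (p.1, w)) p.2

section PartialDerivatives

open scoped ContDiff

variable {V : Type*} [NormedAddCommGroup V] [NormedSpace ℂ V]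
  {U : Set (ℂ × ℂ)} {f g : ℂ × ℂ → V} {p : ℂ × ℂ}

theorem pd1_eq_fderiv (hf : DifferentiableAt ℂ f p) : pd1 f p = fderiv ℂ f p (1, 0) := by
  have h : HasDerivAt (fun w : ℂ => (w, p.2)) ((1 : ℂ), (0 : ℂ)) p.1 :=
    (hasDerivAt_id p.1).prodMk (hasDerivAt_const p.1 p.2)
  exact (HasFDerivAt.comp_hasDerivAt (l := f) p.1 hf.hasFDerivAt h).deriv

theorem pd2_eq_fderiv (hf : DifferentiableAt ℂ f p) : pd2 f p = fderiv ℂ f p (0, 1) := by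
  have h : HasDerivAt (fun w : ℂ => (p.1, w)) ((0 : ℂ), (1 : ℂ)) p.2 :=
    (hasDerivAt_const p.2 p.1).prodMk (hasDerivAt_id p.2)
  exact (HasFDerivAt.comp_hasDerivAt (l := f) p.2 hf.hasFDerivAt h).deriv

theorem pd1_congr (hU : IsOpen U) (h : Set.EqOn f g U) : Set.EqOn (pd1 f) (pd1 g) U := by
  intro p hp
  refine Filter.EventuallyEq.deriv_eq ?_
  have hc : Continuous fun w : ℂ => (w, p.2) := by fun_prop
  filter_upwards [(hU.preimage hc).mem_nhds hp] with w hw using h hw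

theorem pd2_congr (hU : IsOpen U) (h : Set.EqOn f g U) : Set.EqOn (pd2 f) (pd2 g) U := by
  intro p hp
  refine Filter.EventuallyEq.deriv_eq ?_
  have hc : Continuous fun w : ℂ => (p.1, w) := by fun_prop
  filter_upwards [(hU.preimage hc).mem_nhds hp] with w hw using h hw

theorem ContDiffOn.differentiableAt_of_isOpen (hf : ContDiffOn ℂ ∞ f U) (hU : IsOpen U)
    (hp : p ∈ U) : DifferentiableAt ℂ f p :=
  (hf.contDiffAt (hU.mem_nhds hp)).differentiableAt (by simp)

theorem ContDiffOn.pd1 (hf : ContDiffOn ℂ ∞ f U) (hU : IsOpen U) :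
    ContDiffOn ℂ ∞ (pd1 f) U :=
  ((hf.fderiv_of_isOpen hU (by simp)).clm_apply contDiffOn_const).congr fun _ hp =>
    pd1_eq_fderiv (hf.differentiableAt_of_isOpen hU hp)

theorem ContDiffOn.pd2 (hf : ContDiffOn ℂ ∞ f U) (hU : IsOpen U) :
    ContDiffOn ℂ ∞ (pd2 f) U :=
  ((hf.fderiv_of_isOpen hU (by simp)).clm_apply contDiffOn_const).congr fun _ hp =>
    pd2_eq_fderiv (hf.differentiableAt_of_isOpen hU hp)

theorem ContDiffOn.iterate_pd1 (hf : ContDiffOn ℂ ∞ f U) (hU : IsOpen U) (n : ℕ) :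
    ContDiffOn ℂ ∞ (_root_.pd1^[n] f) U := by
  induction n with
  | zero => exact hf
  | succ n ih =>
    rw [Function.iterate_succ_apply']
    exact ih.pd1 hU

theorem pd2_pd1_comm (hf : ContDiffOn ℂ ∞ f U) (hU : IsOpen U) :
    Set.EqOn (pd2 (pd1 f)) (pd1 (pd2 f)) U := by
  intro p hp
  have hd : DifferentiableAt ℂ (fderiv ℂ f) p :=
    ((hf.fderiv_of_isOpen hU (m := ∞) (by simp)).contDiffAt
      (hU.mem_nhds hp)).differentiableAt (by simp)
  have h1 : Set.EqOn (pd1 f) (fun q => fderiv ℂ f q (1, 0)) U := fun q hq =>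
    pd1_eq_fderiv (hf.differentiableAt_of_isOpen hU hq)
  have h2 : Set.EqOn (pd2 f) (fun q => fderiv ℂ f q (0, 1)) U := fun q hq =>
    pd2_eq_fderiv (hf.differentiableAt_of_isOpen hU hq)
  have hs : IsSymmSndFDerivAt ℂ f p :=
    (hf.contDiffAt (hU.mem_nhds hp)).isSymmSndFDerivAt (by simpa using WithTop.coe_le_coe.2 (le_top (a := (2 : ℕ∞))))
  have hv (v : ℂ × ℂ) : HasFDerivAt (fun q => fderiv ℂ f q v)
      ((fderiv ℂ (fderiv ℂ f) p).flip v) p := by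
    simpa using hd.hasFDerivAt.clm_apply (hasFDerivAt_const v p)
  rw [pd2_congr hU h1 hp, pd1_congr hU h2 hp, pd2_eq_fderiv (hv _).differentiableAt,
    pd1_eq_fderiv (hv _).differentiableAt, (hv _).fderiv, (hv _).fderiv]
  exact hs.eq _ _

theorem pd2_iterate_pd1_comm (hf : ContDiffOn ℂ ∞ f U) (hU : IsOpen U) (n : ℕ) :
    Set.EqOn (pd2 (pd1^[n] f)) (pd1^[n] (pd2 f)) U := by
  induction n with
  | zero => exact fun _ _ => rfl
  | succ n ih =>
    simp only [Function.iterate_succ_apply']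
    exact (pd2_pd1_comm (hf.iterate_pd1 hU n) hU).trans (pd1_congr hU ih)

theorem pd1_bilin (B : V →L[ℂ] V →L[ℂ] ℂ) (hf : DifferentiableAt ℂ f p)
    (hg : DifferentiableAt ℂ g p) :
    pd1 (fun q => B (f q) (g q)) p = B (pd1 f p) (g p) + B (f p) (pd1 g p) := by
  have h := B.hasFDerivAt_of_bilinear hf.hasFDerivAt hg.hasFDerivAt
  rw [pd1_eq_fderiv h.differentiableAt, h.fderiv, pd1_eq_fderiv hf, pd1_eq_fderiv hg]
  simp [add_comm]

theorem pd2_bilin (B : V →L[ℂ] V →L[ℂ] ℂ) (hf : DifferentiableAt ℂ f p)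
    (hg : DifferentiableAt ℂ g p) :
    pd2 (fun q => B (f q) (g q)) p = B (pd2 f p) (g p) + B (f p) (pd2 g p) := by
  have h := B.hasFDerivAt_of_bilinear hf.hasFDerivAt hg.hasFDerivAt
  rw [pd2_eq_fderiv h.differentiableAt, h.fderiv, pd2_eq_fderiv hf, pd2_eq_fderiv hg]
  simp [add_comm]

theorem pd1_eq_zero_of_eqOn (hU : IsOpen U) (h : ∀ q ∈ U, f q = 0) (hp : p ∈ U) :
    pd1 f p = 0 := by
  rw [pd1_congr hU (g := fun _ => 0) h hp]
  simp [pd1]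

end PartialDerivatives

/-- Griffiths transversality relation
`W^{(4,1)} = (1/2)(∂₂W^{(4,0)} + 4∂₁W^{(3,1)})`. -/
theorem statement13 {V : Type*} [NormedAddCommGroup V] [NormedSpace ℂ V]
    (B : V →L[ℂ] V →L[ℂ] ℂ) (hB : ∀ u v : V, B u v = B v u)
    (U : Set (ℂ × ℂ)) (hU : IsOpen U) (Ω : ℂ × ℂ → V) (hΩ : ContDiffOn ℂ ⊤ Ω U)
    (h0 : ∀ p ∈ U, ∀ i j : ℕ, i + j ≤ 3 → B (Ω p) (pd1^[i] (pd2^[j] Ω) p) = 0) :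
    ∀ p ∈ U,
      B (Ω p) (pd1^[4] (pd2^[1] Ω) p)
        = (1 / 2) * (pd2 (fun q => B (Ω q) (pd1^[4] Ω q)) p
            + 4 * pd1 (fun q => B (Ω q) (pd1^[3] (pd2^[1] Ω) q)) p) := by
  have hs : ContDiffOn ℂ ((⊤ : ℕ∞) : WithTop ℕ∞) Ω U := hΩ.of_le le_top
  have hA (n : ℕ) := hs.iterate_pd1 hU n
  have hC (n : ℕ) := (hs.pd2 hU).iterate_pd1 hU n
  have dA (n : ℕ) {q} (hq : q ∈ U) := (hA n).differentiableAt_of_isOpen hU hq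
  have dC (n : ℕ) {q} (hq : q ∈ U) := (hC n).differentiableAt_of_isOpen hU hq
  have comm (n : ℕ) {q} (hq : q ∈ U) := pd2_iterate_pd1_comm hs hU n hq
  have step (n : ℕ) (f : ℂ × ℂ → V) : pd1 (pd1^[n] f) = pd1^[n + 1] f :=
    (Function.iterate_succ_apply' pd1 n f).symm
  have d1 {q} (hq : q ∈ U) : DifferentiableAt ℂ (pd1 Ω) q := dA 1 hq
  have d0 {q} (hq : q ∈ U) : DifferentiableAt ℂ Ω q := dA 0 hq
  have zeroth (n : ℕ) (hn : n ≤ 3) (q) (hq : q ∈ U) : B (Ω q) (pd1^[n] Ω q) = 0 :=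
    h0 q hq n 0 (by omega)
  have diff1 (n : ℕ) (hn : n ≤ 3) (q) (hq : q ∈ U) :
      B (pd1 Ω q) (pd1^[n] Ω q) + B (Ω q) (pd1^[n + 1] Ω q) = 0 := by
    rw [← step, ← pd1_bilin B (d0 hq) (dA n hq)]
    exact pd1_eq_zero_of_eqOn hU (zeroth n hn) hq
  have h12 (q) (hq : q ∈ U) : B (pd1 Ω q) (pd1^[2] Ω q) = 0 := by
    linear_combination diff1 2 (by norm_num) q hq - zeroth 3 le_rfl q hq
  have h22 (q) (hq : q ∈ U) :
      B (pd1^[2] Ω q) (pd1^[2] Ω q) = B (Ω q) (pd1^[4] Ω q) := by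
    have h := pd1_eq_zero_of_eqOn hU h12 hq
    rw [pd1_bilin B (d1 hq) (dA 2 hq), step 2] at h
    change B (pd1^[2] Ω q) _ + _ = 0 at h
    linear_combination h - diff1 3 le_rfl q hq
  have h21 (q) (hq : q ∈ U) :
      B (pd1 Ω q) (pd1^[2] (pd2 Ω) q) + B (Ω q) (pd1^[3] (pd2 Ω) q) = 0 := by
    have h := pd1_eq_zero_of_eqOn hU (fun q hq => h0 q hq 2 1 le_rfl) hq
    rwa [Function.iterate_one, pd1_bilin B (d0 hq) (dC 2 hq), step] at h
  intro p hp
  have e1 := pd2_congr hU h22 hp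
  rw [pd2_bilin B (dA 2 hp) (dA 2 hp), pd2_bilin B (d0 hp) (dA 4 hp), comm 2 hp, comm 4 hp,
    hB (pd1^[2] (pd2 Ω) p)] at e1
  have e2 := pd1_congr hU (f := fun q => B (pd1 Ω q) (pd1^[2] (pd2 Ω) q))
    (g := fun q => B (-Ω q) (pd1^[3] (pd2 Ω) q))
    (fun q hq => by simpa using eq_neg_of_add_eq_zero_left (h21 q hq)) hp
  have hneg : pd1 (fun q => -Ω q) p = -pd1 Ω p := by simp [pd1, deriv.fun_neg]
  rw [pd1_bilin B (d1 hp) (dC 2 hp), pd1_bilin B (d0 hp).fun_neg (dC 3 hp), step 2, step 3,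
    hneg, map_neg, map_neg, neg_apply, neg_apply] at e2
  change B (pd1^[2] Ω p) _ + _ = _ at e2
  rw [Function.iterate_one, pd2_bilin B (d0 hp) (dA 4 hp), pd1_bilin B (d0 hp) (dC 3 hp),
    comm 4 hp, step 3]
  linear_combination (1 / 2) * e1 - e2
end

section
/- For every real t ≥ 1, the value x(t) := (1/2)·(1 − E6(it)/E4(it)^{3/2}) lies in [0, 1/2], and the Gauss hypergeometric series satisfies ₂F₁(1/6, 5/6; 1; x(t)) = E4(it)^{1/4}, where E4(it)^{3/2} and E4(it)^{1/4} denote the positive real powers of the positive real number E4(it). -/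
/-- The nome `q = e^{2πi(it)} = e^{−2πt}` for `τ = it`. -/
noncomputable def nome (t : ℝ) : ℝ := Real.exp (-2 * Real.pi * t)

/-- `E4(it) = 1 + 240·Σ_{n≥1} σ₃(n) q^n`. -/
noncomputable def E4val (t : ℝ) : ℝ :=
  1 + 240 * ∑' n : ℕ, (∑ d ∈ Nat.divisors (n + 1), (d : ℝ) ^ 3) * nome t ^ (n + 1)

/-- `E6(it) = 1 − 504·Σ_{n≥1} σ₅(n) q^n`. -/
noncomputable def E6val (t : ℝ) : ℝ :=
  1 - 504 * ∑' n : ℕ, (∑ d ∈ Nat.divisors (n + 1), (d : ℝ) ^ 5) * nome t ^ (n + 1)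

/-- `x(t) = (1/2)(1 − E6(it)/E4(it)^{3/2})`, with the positive real power. -/
noncomputable def xval (t : ℝ) : ℝ :=
  (1 / 2) * (1 - E6val t / E4val t ^ ((3 : ℝ) / 2))

/-- The Gauss hypergeometric series `₂F₁(α, β; 1; x)`. -/
noncomputable def gauss2F1 (α β : ℝ) (x : ℝ) : ℝ :=
  ∑' k : ℕ,
    ((ascPochhammer ℝ k).eval α * (ascPochhammer ℝ k).eval β / ((k.factorial : ℝ)) ^ 2) * x ^ k

section RamanujanIdentities

open UpperHalfPlane hiding I
open Complex Filter Topology ModularForm Derivative ArithmeticFunction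
open scoped Manifold MatrixGroups Real

/-- The divisor power series `∑ σ_k(n) qⁿ` tends to zero at `i∞`. -/
lemma tendsto_tsum_sigma_mul_cexp_atImInfty (k : ℕ) :
    Tendsto (fun z : ℍ ↦ ∑' n : ℕ+, (sigma k n : ℂ) * cexp (2 * π * I * z) ^ (n : ℕ))
      atImInfty (𝓝 0) := by
  have hq : Tendsto (fun q : ℂ ↦ ∑' n : ℕ+, (sigma k n : ℂ) * q ^ (n : ℕ)) (𝓝 0) (𝓝 0) := by
    have hs : Summable fun n : ℕ ↦ (n : ℝ) ^ (k + 1) * (1 / 2 : ℝ) ^ n :=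
      summable_pow_mul_geometric_of_norm_lt_one (k + 1) (by norm_num)
    have := tendsto_tsum_of_dominated_convergence (𝓕 := 𝓝 (0 : ℂ)) (g := fun _ : ℕ+ ↦ (0 : ℂ))
      (f := fun (q : ℂ) (n : ℕ+) ↦ (sigma k n : ℂ) * q ^ (n : ℕ))
      (bound := fun n : ℕ+ ↦ (n : ℝ) ^ (k + 1) * (1 / 2 : ℝ) ^ (n : ℕ))
      (hs.comp_injective PNat.coe_injective) (fun n ↦ ?_) ?_
    · simpa using this
    · have : Continuous fun q : ℂ ↦ (sigma k n : ℂ) * q ^ (n : ℕ) := by fun_prop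
      simpa using this.tendsto 0
    · filter_upwards [Metric.ball_mem_nhds (0 : ℂ) (by norm_num : (0 : ℝ) < 1 / 2)] with q hq n
      rw [norm_mul, norm_pow, Complex.norm_natCast]
      gcongr
      · exact_mod_cast sigma_le_pow_succ k n
      · exact (mem_ball_zero_iff.mp hq).le
  refine (hq.comp (qParam_tendsto_atImInfty one_pos)).congr fun z ↦ ?_
  simp [Function.Periodic.qParam]

lemma EisensteinSeries.tendsto_E2_atImInfty : Tendsto EisensteinSeries.E2 atImInfty (𝓝 1) := by
  have := ((tendsto_tsum_sigma_mul_cexp_atImInfty 1).const_mul (-24)).const_add 1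
  simp only [mul_zero, add_zero] at this
  refine this.congr fun z ↦ ?_
  rw [EisensteinSeries.E2_eq_tsum_cexp]
  ring

lemma ModularForm.tendsto_E_atImInfty {k : ℕ} (hk : 3 ≤ k) (hk2 : Even k) :
    Tendsto (E hk) atImInfty (𝓝 1) := by
  have := ((tendsto_tsum_sigma_mul_cexp_atImInfty (k - 1)).const_mul
    (-(2 * k / bernoulli k : ℂ))).const_add 1
  simp only [mul_zero, add_zero] at this
  refine this.congr fun z ↦ ?_
  rw [EisensteinSeries.q_expansion_bernoulli hk hk2]
  simp only [zpow_natCast]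
  ring

/-- The derivative of a holomorphic function with a limit at `i∞` tends to zero there. -/
lemma tendsto_normalizedDerivOfComplex_atImInfty {F : ℍ → ℂ} (hF : MDiff F) {c : ℂ}
    (hc : Tendsto F atImInfty (𝓝 c)) :
    Tendsto (normalizedDerivOfComplex F) atImInfty (𝓝 0) := by
  rw [Metric.tendsto_nhds]
  intro ε hε
  have h := (Metric.tendsto_nhds.mp hc) ε hε
  obtain ⟨A, hA⟩ := (atImInfty_mem _).mp h
  refine (atImInfty_mem _).mpr ⟨max A 0 + 2, fun z hz ↦ ?_⟩
  have him : ∀ w ∈ Metric.closedBall (z : ℂ) 1, max A 0 < w.im := fun w hw ↦ by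
    have h1 := (Complex.abs_im_le_norm (w - z)).trans (mem_closedBall_iff_norm.mp hw)
    rw [Complex.sub_im, abs_le] at h1
    have : (z : ℂ).im = z.im := rfl
    linarith [h1.1]
  have hd : DiffContOnCl ℂ (fun w ↦ (F ∘ ofComplex) w - c) (Metric.ball (z : ℂ) 1) := by
    apply DifferentiableOn.diffContOnCl
    rw [closure_ball _ one_ne_zero]
    exact ((UpperHalfPlane.mdifferentiable_iff.mp hF).mono
      fun w hw ↦ (le_max_right A 0).trans_lt (him w hw)).sub_const c
  have hb := Complex.norm_deriv_le_of_forall_mem_sphere_norm_le one_pos hd (C := ε) fun w hw ↦ by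
    have hw' := him w (Metric.sphere_subset_closedBall hw)
    have hw0 : 0 < w.im := (le_max_right A 0).trans_lt hw'
    have := hA ⟨w, hw0⟩ ((le_max_left A 0).trans hw'.le)
    simp only [Set.mem_ofPred_eq, dist_eq_norm] at this
    simpa [ofComplex_apply_of_im_pos hw0] using this.le
  simp only [Function.comp_apply] at hb
  rw [deriv_sub_const, div_one] at hb
  rw [Set.mem_ofPred_eq, dist_zero_right, normalizedDerivOfComplex, norm_mul, norm_inv]
  have hpi : 1 < ‖(2 * π * I : ℂ)‖ := by
    simp only [norm_mul, Complex.norm_I, Complex.norm_real, Real.norm_eq_abs,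
      abs_of_pos Real.pi_pos, RCLike.norm_ofNat, mul_one]
    linarith [Real.pi_gt_three]
  calc ‖(2 * π * I : ℂ)‖⁻¹ * ‖deriv (F ∘ ofComplex) z‖ ≤ ‖(2 * π * I : ℂ)‖⁻¹ * ε := by
        gcongr; exact hb
    _ < 1 * ε := by gcongr; exact inv_lt_one_of_one_lt₀ hpi
    _ = ε := one_mul ε

/-- If level one forms of weight `k` are spanned by a form `G` normalised at `i∞`, then an
invariant holomorphic function with limit `c` at `i∞` equals `c • G`. -/
lemma ModularForm.eq_const_mul_of_rank_eq_one {k : ℤ} (G : ModularForm 𝒮ℒ k)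
    (hr : Module.rank ℂ (ModularForm 𝒮ℒ k) = 1) (hG : Tendsto G atImInfty (𝓝 1))
    {F : ℍ → ℂ} (hF : MDiff F) (hinv : ∀ γ : SL(2, ℤ), F ∣[k] γ = F) {c : ℂ}
    (hc : Tendsto F atImInfty (𝓝 c)) (z : ℍ) : F z = c * G z := by
  let f : ModularForm 𝒮ℒ k :=
    { toFun := F
      slash_action_eq' := fun _ ⟨γ, hγ⟩ ↦ hγ ▸ hinv γ
      holo' := hF
      bdd_at_cusps' := fun {c} hc' ↦ by
        rw [Subgroup.IsArithmetic.isCusp_iff_isCusp_SL2Z] at hc'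
        rw [OnePoint.isBoundedAt_iff_forall_SL2Z hc']
        intro γ _
        rw [hinv γ]
        exact hc.isBigO_one ℝ }
  have hne : G ≠ 0 := by
    rintro rfl
    exact zero_ne_one (tendsto_nhds_unique tendsto_const_nhds hG)
  obtain ⟨d, hd⟩ := (finrank_eq_one_iff_of_nonzero' G hne).mp
    (Module.rank_eq_one_iff_finrank_eq_one.mp hr) f
  have hFd : ∀ w, F w = d * G w := fun w ↦ (DFunLike.congr_fun hd w).symm
  have : Tendsto F atImInfty (𝓝 (d * 1)) := (hG.const_mul d).congr fun w ↦ (hFd w).symm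
  rw [hFd, tendsto_nhds_unique hc this, mul_one]

lemma tendsto_serreDerivative_atImInfty {F : ℍ → ℂ} (hF : MDiff F) {c : ℂ} (k : ℂ)
    (hc : Tendsto F atImInfty (𝓝 c)) :
    Tendsto (serreDerivative k F) atImInfty (𝓝 (-(k * 12⁻¹ * c))) := by
  have := (tendsto_normalizedDerivOfComplex_atImInfty hF hc).sub
    ((EisensteinSeries.tendsto_E2_atImInfty.const_mul (k * 12⁻¹)).mul hc)
  simpa using this

/-- Ramanujan's identity `D E₄ = (E₂ E₄ - E₆) / 3`. -/
theorem normalizedDerivOfComplex_E₄ (z : ℍ) :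
    normalizedDerivOfComplex E₄ z = (EisensteinSeries.E2 z * E₄ z - E₆ z) / 3 := by
  have h4 : MDiff (E₄ : ℍ → ℂ) := E₄.holo'
  have := eq_const_mul_of_rank_eq_one E₆ levelOne_weight_six_rank_one
    (tendsto_E_atImInfty _ ⟨3, rfl⟩) (serreDerivative_mdifferentiable (4 : ℤ) h4)
    (fun γ ↦ serreDerivative_slash_invariant h4 (SlashInvariantForm.slash_action_eqn E₄ _ ⟨γ, rfl⟩))
    (tendsto_serreDerivative_atImInfty h4 _ (tendsto_E_atImInfty _ ⟨2, rfl⟩)) z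
  rw [serreDerivative_apply] at this
  push_cast at this
  linear_combination this

/-- Ramanujan's identity `D E₆ = (E₂ E₆ - E₄²) / 2`. -/
theorem normalizedDerivOfComplex_E₆ (z : ℍ) :
    normalizedDerivOfComplex E₆ z = (EisensteinSeries.E2 z * E₆ z - E₄ z ^ 2) / 2 := by
  have h6 : MDiff (E₆ : ℍ → ℂ) := E₆.holo'
  have hr : Module.rank ℂ (ModularForm 𝒮ℒ 8) = 1 := by
    simpa [Nat.ModEq] using dimension_level_one 8 ⟨4, rfl⟩
  have h44 : Tendsto (E₄.mul E₄) atImInfty (𝓝 1) := by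
    have h4 := tendsto_E_atImInfty (by norm_num : 3 ≤ 4) ⟨2, rfl⟩
    simpa using! h4.mul h4
  have := eq_const_mul_of_rank_eq_one (E₄.mul E₄) hr
    h44 (serreDerivative_mdifferentiable (6 : ℤ) h6)
    (fun γ ↦ serreDerivative_slash_invariant h6 (SlashInvariantForm.slash_action_eqn E₆ _ ⟨γ, rfl⟩))
    (tendsto_serreDerivative_atImInfty h6 _ (tendsto_E_atImInfty _ ⟨3, rfl⟩)) z
  rw [serreDerivative_apply, ModularForm.coe_mul, Pi.mul_apply] at this
  push_cast at this
  linear_combination this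

lemma normalizedDerivOfComplex_D2 (γ : SL(2, ℤ)) (z : ℍ) :
    normalizedDerivOfComplex (EisensteinSeries.D2 γ) z = -((γ 1 0 : ℂ) / denom γ z) ^ 2 := by
  have hz := denom_ne_zero γ z
  have h1 : HasDerivAt (fun w ↦ (denom γ w) ^ (-1 : ℤ))
      (-1 * (γ 1 0 : ℂ) * (denom γ z) ^ (-1 - 1 : ℤ)) (z : ℂ) := by
    simpa using hasDerivAt_denom_zpow γ (-1) z
  have h2 : (EisensteinSeries.D2 γ ∘ ofComplex) =ᶠ[𝓝 (z : ℂ)]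
      fun w ↦ (2 * π * I * γ 1 0) * (denom γ w) ^ (-1 : ℤ) := by
    filter_upwards [isOpen_upperHalfPlaneSet.mem_nhds z.im_pos] with w hw
    simp [EisensteinSeries.D2, ofComplex_apply_of_im_pos hw, div_eq_mul_inv]
  rw [normalizedDerivOfComplex, ((h1.const_mul _).congr_of_eventuallyEq h2).deriv,
    show (-1 - 1 : ℤ) = -2 by rfl, zpow_neg]
  simp only [mul_inv, zpow_ofNat]
  field [Complex.two_pi_I_ne_zero]

lemma mdifferentiable_D2 (γ : SL(2, ℤ)) : MDiff (EisensteinSeries.D2 γ) := by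
  simpa only [EisensteinSeries.D2, div_eq_mul_inv] using!
    (mdifferentiable_const (c := (2 * π * I * γ 1 0 : ℂ))).mul (mdifferentiable_inv_denom γ)

/-- The weight one Serre derivative of `E₂` is modular of weight four. -/
lemma serreDerivative_E2_slash (γ : SL(2, ℤ)) :
    serreDerivative 1 EisensteinSeries.E2 ∣[(4 : ℤ)] γ = serreDerivative 1 EisensteinSeries.E2 := by
  have hE := EisensteinSeries.E2_slash_action γ
  have hD := normalizedDerivOfComplex_SL_slash (k := 2) E2_mdifferentiable (γ := γ)
  have hserre : serreDerivative 1 EisensteinSeries.E2 =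
      normalizedDerivOfComplex EisensteinSeries.E2 -
        (12⁻¹ : ℂ) • (EisensteinSeries.E2 * EisensteinSeries.E2) := by
    ext z
    simp [mul_assoc]
  rw [hE, normalizedDerivOfComplex_sub _ _ E2_mdifferentiable ((mdifferentiable_D2 γ).const_smul _),
    normalizedDerivOfComplex_smul _ _ (mdifferentiable_D2 γ)] at hD
  have hM := ModularForm.mul_slash_SL2 2 2 γ EisensteinSeries.E2 EisensteinSeries.E2
  rw [hE] at hM
  rw [hserre, sub_eq_add_neg, SlashAction.add_slash, SlashAction.neg_slash, SL_smul_slash]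
  ext z
  have hDz := congrFun hD z
  have hMz := congrFun hM z
  simp only [Pi.sub_apply, Pi.smul_apply, smul_eq_mul, normalizedDerivOfComplex_D2,
    Pi.mul_apply, EisensteinSeries.D2, riemannZeta_two] at hDz hMz
  simp only [Pi.add_apply, Pi.neg_apply, Pi.smul_apply, Pi.mul_apply, smul_eq_mul]
  norm_num at hDz hMz
  rw [hMz]
  rw [← sub_eq_zero] at hDz
  have hπ : (π : ℂ) ≠ 0 := ofReal_ne_zero.mpr Real.pi_ne_zero
  simp only [mul_div_assoc] at hDz ⊢
  generalize ((γ 1 0 : ℂ) / denom γ z) = q at hDz ⊢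
  field_simp at hDz ⊢
  grind [I_sq]

/-- Ramanujan's identity `D E₂ = (E₂² - E₄) / 12`. -/
theorem normalizedDerivOfComplex_E2 (z : ℍ) :
    normalizedDerivOfComplex EisensteinSeries.E2 z = (EisensteinSeries.E2 z ^ 2 - E₄ z) / 12 := by
  have := eq_const_mul_of_rank_eq_one E₄ levelOne_weight_four_rank_one
    (tendsto_E_atImInfty _ ⟨2, rfl⟩)
    (serreDerivative_mdifferentiable 1 E2_mdifferentiable)
    serreDerivative_E2_slash
    (tendsto_serreDerivative_atImInfty E2_mdifferentiable 1
      EisensteinSeries.tendsto_E2_atImInfty) z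
  rw [serreDerivative_apply] at this
  linear_combination this

end RamanujanIdentities

section ImaginaryAxis

open UpperHalfPlane hiding I
open Complex Filter Topology ModularForm Derivative ArithmeticFunction
open scoped Manifold MatrixGroups Real

lemma coe_ofComplex_I_mul {t : ℝ} (ht : 0 < t) : (ofComplex (I * t) : ℂ) = I * t :=
  ofComplex_apply_of_im_pos (z := I * t) (by simpa using ht) ▸ rfl

lemma tendsto_ofComplex_I_mul_atImInfty :
    Tendsto (fun t : ℝ ↦ ofComplex (I * t)) atTop atImInfty := by
  rw [atImInfty, tendsto_comap_iff]
  refine tendsto_id.congr' ?_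
  filter_upwards [eventually_gt_atTop 0] with t ht
  simp [ofComplex_apply_of_im_pos, ht, ← coe_im]

lemma cexp_two_pi_I_mul_ofComplex {t : ℝ} (ht : 0 < t) :
    cexp (2 * π * I * ofComplex (I * t)) = (nome t : ℂ) := by
  rw [coe_ofComplex_I_mul ht, nome, ofReal_exp]
  congr 1
  push_cast
  linear_combination 2 * π * t * I_mul_I

/-- Along the imaginary axis, `d/dt = -2π D`. -/
lemma hasDerivAt_re_imaginary_axis {F : ℍ → ℂ} (hF : MDiff F) {t : ℝ} (ht : 0 < t) :
    HasDerivAt (fun s : ℝ ↦ (F (ofComplex (I * s))).re)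
      (-(2 * π) * (normalizedDerivOfComplex F (ofComplex (I * t))).re) t := by
  have hd : DifferentiableAt ℂ (F ∘ ofComplex) (I * t) :=
    (UpperHalfPlane.mdifferentiable_iff.mp hF).differentiableAt
      (isOpen_upperHalfPlaneSet.mem_nhds (by simpa using ht))
  have h1 : HasDerivAt (fun w : ℂ ↦ I * w) I (t : ℂ) := by
    simpa using (hasDerivAt_id (t : ℂ)).const_mul I
  have h2 := (HasDerivAt.comp (t : ℂ) hd.hasDerivAt h1).real_of_complex
  refine h2.congr_deriv ?_
  rw [normalizedDerivOfComplex, coe_ofComplex_I_mul ht]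
  have : deriv (F ∘ ofComplex) (I * t) * I =
      ((-(2 * π) : ℝ) : ℂ) * ((2 * π * I)⁻¹ * deriv (F ∘ ofComplex) (I * t)) := by
    have hπ : (π : ℂ) ≠ 0 := ofReal_ne_zero.mpr Real.pi_ne_zero
    push_cast
    field_simp
    linear_combination deriv (F ∘ ofComplex) (I * t) * I_mul_I
  rw [this, re_ofReal_mul]

lemma tsum_sigma_mul_cexp_imaginary_axis (k : ℕ) {t : ℝ} (ht : 0 < t) :
    ∑' n : ℕ+, (sigma k n : ℂ) * cexp (2 * π * I * ofComplex (I * t)) ^ (n : ℕ) =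
      ((∑' n : ℕ, (∑ d ∈ Nat.divisors (n + 1), (d : ℝ) ^ k) * nome t ^ (n + 1) : ℝ) : ℂ) := by
  rw [cexp_two_pi_I_mul_ofComplex ht,
    tsum_pnat_eq_tsum_succ (f := fun n ↦ (sigma k n : ℂ) * (nome t : ℂ) ^ n), ofReal_tsum]
  simp [sigma_apply]

lemma summable_sigma_mul_nome_pow (k : ℕ) {t : ℝ} (ht : 0 < t) :
    Summable fun n : ℕ ↦ (∑ d ∈ Nat.divisors (n + 1), (d : ℝ) ^ k) * nome t ^ (n + 1) := by
  have h := EisensteinSeries.summable_sigma_mul_cexp_pow (k := k + 1) (by omega)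
    (ofComplex (I * t))
  rw [cexp_two_pi_I_mul_ofComplex ht] at h
  have h' := (summable_nat_add_iff 1).mpr h
  rw [← Complex.summable_ofReal]
  simpa [sigma_apply] using h'

lemma E₄_imaginary_axis {t : ℝ} (ht : 0 < t) : E₄ (ofComplex (I * t)) = (E4val t : ℂ) := by
  have hb : bernoulli 4 = -1 / 30 := by decide +kernel
  rw [EisensteinSeries.q_expansion_bernoulli (by norm_num) ⟨2, rfl⟩, hb]
  simp only [zpow_natCast]
  rw [tsum_sigma_mul_cexp_imaginary_axis _ ht, E4val]
  push_cast
  ring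

lemma E₆_imaginary_axis {t : ℝ} (ht : 0 < t) : E₆ (ofComplex (I * t)) = (E6val t : ℂ) := by
  have hb : bernoulli 6 = 1 / 42 := by decide +kernel
  rw [EisensteinSeries.q_expansion_bernoulli (by norm_num) ⟨3, rfl⟩, hb]
  simp only [zpow_natCast]
  rw [tsum_sigma_mul_cexp_imaginary_axis _ ht, E6val]
  push_cast
  ring

/-- `E₂(it)` as a real number. -/
noncomputable def E2val (t : ℝ) : ℝ := (EisensteinSeries.E2 (ofComplex (I * t))).re

lemma E2_imaginary_axis {t : ℝ} (ht : 0 < t) :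
    EisensteinSeries.E2 (ofComplex (I * t)) = (E2val t : ℂ) := by
  rw [E2val, EisensteinSeries.E2_eq_tsum_cexp, tsum_sigma_mul_cexp_imaginary_axis _ ht]
  norm_cast

lemma hasDerivAt_E2val {t : ℝ} (ht : 0 < t) :
    HasDerivAt E2val (-(2 * π) * ((E2val t ^ 2 - E4val t) / 12)) t := by
  have h := hasDerivAt_re_imaginary_axis E2_mdifferentiable ht
  rw [normalizedDerivOfComplex_E2, E2_imaginary_axis ht, E₄_imaginary_axis ht] at h
  norm_cast at h

lemma hasDerivAt_E4val {t : ℝ} (ht : 0 < t) :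
    HasDerivAt E4val (-(2 * π) * ((E2val t * E4val t - E6val t) / 3)) t := by
  have h := hasDerivAt_re_imaginary_axis (F := E₄) E₄.holo' ht
  rw [normalizedDerivOfComplex_E₄, E2_imaginary_axis ht, E₄_imaginary_axis ht,
    E₆_imaginary_axis ht] at h
  norm_cast at h
  refine h.congr_of_eventuallyEq ?_
  filter_upwards [lt_mem_nhds ht] with s hs
  rw [E₄_imaginary_axis hs, ofReal_re]

lemma hasDerivAt_E6val {t : ℝ} (ht : 0 < t) :
    HasDerivAt E6val (-(2 * π) * ((E2val t * E6val t - E4val t ^ 2) / 2)) t := by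
  have h := hasDerivAt_re_imaginary_axis (F := E₆) E₆.holo' ht
  rw [normalizedDerivOfComplex_E₆, E2_imaginary_axis ht, E₄_imaginary_axis ht,
    E₆_imaginary_axis ht] at h
  norm_cast at h
  refine h.congr_of_eventuallyEq ?_
  filter_upwards [lt_mem_nhds ht] with s hs
  rw [E₆_imaginary_axis hs, ofReal_re]

lemma tendsto_E2val : Tendsto E2val atTop (𝓝 1) :=
  (Complex.continuous_re.tendsto _).comp
    (EisensteinSeries.tendsto_E2_atImInfty.comp tendsto_ofComplex_I_mul_atImInfty)

lemma tendsto_E4val : Tendsto E4val atTop (𝓝 1) := by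
  refine ((Complex.continuous_re.tendsto _).comp ((tendsto_E_atImInfty (k := 4) (by norm_num)
    ⟨2, rfl⟩).comp tendsto_ofComplex_I_mul_atImInfty)).congr' ?_
  filter_upwards [eventually_gt_atTop 0] with t ht
  simp [E₄_imaginary_axis ht]

lemma tendsto_E6val : Tendsto E6val atTop (𝓝 1) := by
  refine ((Complex.continuous_re.tendsto _).comp ((tendsto_E_atImInfty (k := 6) (by norm_num)
    ⟨3, rfl⟩).comp tendsto_ofComplex_I_mul_atImInfty)).congr' ?_
  filter_upwards [eventually_gt_atTop 0] with t ht
  simp [E₆_imaginary_axis ht]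

lemma nome_nonneg (t : ℝ) : 0 ≤ nome t := (Real.exp_pos _).le

lemma one_le_E4val (t : ℝ) : 1 ≤ E4val t := by
  have : 0 ≤ ∑' n : ℕ, (∑ d ∈ Nat.divisors (n + 1), (d : ℝ) ^ 3) * nome t ^ (n + 1) :=
    tsum_nonneg fun n ↦ mul_nonneg (by positivity) (pow_nonneg (nome_nonneg t) _)
  rw [E4val]
  linarith

lemma E6val_le_one (t : ℝ) : E6val t ≤ 1 := by
  have : 0 ≤ ∑' n : ℕ, (∑ d ∈ Nat.divisors (n + 1), (d : ℝ) ^ 5) * nome t ^ (n + 1) :=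
    tsum_nonneg fun n ↦ mul_nonneg (by positivity) (pow_nonneg (nome_nonneg t) _)
  rw [E6val]
  linarith

lemma E6val_one : E6val 1 = 0 := by
  have h1 := E₆_imaginary_axis one_pos
  have hI : ofComplex (I * (1 : ℝ)) = UpperHalfPlane.I := by
    ext
    rw [coe_ofComplex_I_mul one_pos]
    simp
  rw [hI] at h1
  have h := congrFun (SlashInvariantForm.slash_action_eqn E₆ _ ⟨ModularGroup.S, rfl⟩)
    UpperHalfPlane.I
  have h2 := SlashInvariantForm.slash_S_apply E₆ 6 UpperHalfPlane.I
  have hI' : (UpperHalfPlane.mk _ UpperHalfPlane.I.im_inv_neg_coe_pos) = UpperHalfPlane.I := by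
    ext
    simp
  rw [hI'] at h2
  have h3 : E₆ UpperHalfPlane.I = E₆ UpperHalfPlane.I * (UpperHalfPlane.I : ℂ) ^ (-6 : ℤ) :=
    h.symm.trans h2
  have h4 : (UpperHalfPlane.I : ℂ) ^ (-6 : ℤ) = -1 := by
    rw [UpperHalfPlane.coe_I, zpow_neg, show (6 : ℤ) = (6 : ℕ) by rfl, zpow_natCast,
      show I ^ 6 = (I ^ 2) ^ 3 by ring, I_sq]
    norm_num
  rw [h4, h1, mul_neg_one] at h3
  norm_cast at h3
  linarith

lemma E6val_nonneg {t : ℝ} (ht : 1 ≤ t) : 0 ≤ E6val t := by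
  have h : ∑' n : ℕ, (∑ d ∈ Nat.divisors (n + 1), (d : ℝ) ^ 5) * nome t ^ (n + 1) ≤
      ∑' n : ℕ, (∑ d ∈ Nat.divisors (n + 1), (d : ℝ) ^ 5) * nome 1 ^ (n + 1) := by
    refine (summable_sigma_mul_nome_pow 5 (by linarith)).tsum_le_tsum (fun n ↦ ?_)
      (summable_sigma_mul_nome_pow 5 one_pos)
    have hn : nome t ≤ nome 1 := Real.exp_le_exp.mpr (by nlinarith [Real.pi_pos])
    have := nome_nonneg t
    gcongr
  have h1 := E6val_one
  rw [E6val] at h1 ⊢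
  linarith

end ImaginaryAxis

section HypergeometricEquation

open Filter Topology

/-- Termwise differentiation of a real power series with bounded coefficients. -/
lemma hasDerivAt_tsum_mul_pow {c : ℕ → ℝ} {C : ℝ} (hc : ∀ k, |c k| ≤ C) {x : ℝ} (hx : |x| < 1) :
    HasDerivAt (fun y ↦ ∑' k, c k * y ^ k) (∑' k : ℕ, (k + 1) * c (k + 1) * x ^ k) x := by
  obtain ⟨r, hxr, hr1⟩ := exists_between hx
  have hr0 : 0 < r := (abs_nonneg x).trans_lt hxr
  have hrn : ‖r‖ < 1 := by rwa [Real.norm_of_nonneg hr0.le]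
  have hC : 0 ≤ C := (abs_nonneg _).trans (hc 0)
  have hu : Summable fun k : ℕ ↦ C * (k * r ^ (k - 1)) := by
    refine ((summable_nat_add_iff 1).mp ?_).mul_left C
    refine ((summable_pow_mul_geometric_of_norm_lt_one 1 hrn).add
      (summable_geometric_of_norm_lt_one hrn)).congr fun k ↦ ?_
    rw [Nat.add_sub_cancel]
    push_cast
    ring
  have hbound : ∀ (k : ℕ) (y : ℝ), y ∈ Metric.ball (0 : ℝ) r →
      ‖c k * (k * y ^ (k - 1))‖ ≤ C * (k * r ^ (k - 1)) := fun k y hy ↦ by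
    rw [mem_ball_zero_iff, Real.norm_eq_abs] at hy
    rw [norm_mul, norm_mul, norm_pow, Real.norm_eq_abs, Real.norm_eq_abs, Real.norm_eq_abs,
      Nat.abs_cast]
    gcongr
    exact hc k
  have hxb : x ∈ Metric.ball (0 : ℝ) r := by simpa using hxr
  have h := hasDerivAt_tsum_of_isPreconnected hu Metric.isOpen_ball
    (convex_ball (0 : ℝ) r).isPreconnected
    (fun k y _ ↦ (hasDerivAt_pow k y).const_mul (c k)) hbound (Metric.mem_ball_self hr0)
    (summable_of_ne_finset_zero (s := {0}) fun k hk ↦ by simp_all) hxb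
  refine h.congr_deriv ?_
  rw [(hu.of_norm_bounded fun k ↦ hbound k x hxb).tsum_eq_zero_add]
  simp only [Nat.cast_zero, zero_mul, mul_zero, zero_add, Nat.add_sub_cancel]
  refine tsum_congr fun k ↦ ?_
  push_cast
  ring

/-- The coefficients of `₂F₁(1/6, 5/6; 1; x)`. -/
noncomputable def sexticCoeff (k : ℕ) : ℝ :=
  (ascPochhammer ℝ k).eval (1 / 6) * (ascPochhammer ℝ k).eval (5 / 6) / (k.factorial : ℝ) ^ 2

lemma sexticCoeff_zero : sexticCoeff 0 = 1 := by simp [sexticCoeff]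

lemma sexticCoeff_succ (k : ℕ) :
    sexticCoeff (k + 1) = (k + 1 / 6) * (k + 5 / 6) / (k + 1) ^ 2 * sexticCoeff k := by
  have hk : (k.factorial : ℝ) ≠ 0 := by positivity
  have hk1 : (k + 1 : ℝ) ≠ 0 := by positivity
  simp only [sexticCoeff, ascPochhammer_succ_eval, Nat.factorial_succ]
  push_cast
  field_simp
  ring

lemma sexticCoeff_nonneg (k : ℕ) : 0 ≤ sexticCoeff k := by
  induction k with
  | zero => simp [sexticCoeff_zero]
  | succ k ih => rw [sexticCoeff_succ]; positivity

lemma sexticCoeff_le_one (k : ℕ) : sexticCoeff k ≤ 1 := by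
  induction k with
  | zero => simp [sexticCoeff_zero]
  | succ k ih =>
    rw [sexticCoeff_succ]
    refine mul_le_one₀ ?_ (sexticCoeff_nonneg k) ih
    rw [div_le_one (by positivity)]
    nlinarith [(Nat.cast_nonneg k : (0 : ℝ) ≤ k)]

lemma abs_sexticCoeff_le_one (k : ℕ) : |sexticCoeff k| ≤ 1 := by
  rw [abs_of_nonneg (sexticCoeff_nonneg k)]
  exact sexticCoeff_le_one k

lemma gauss2F1_eq_tsum_sexticCoeff (x : ℝ) :
    gauss2F1 (1 / 6) (5 / 6) x = ∑' k, sexticCoeff k * x ^ k := rfl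

/-- The derivative of `₂F₁(1/6, 5/6; 1; x)`. -/
noncomputable def sexticDeriv (x : ℝ) : ℝ :=
  ∑' k : ℕ, (k + 1) * sexticCoeff (k + 1) * x ^ k

lemma hasDerivAt_gauss2F1_sextic {x : ℝ} (hx : |x| < 1) :
    HasDerivAt (gauss2F1 (1 / 6) (5 / 6)) (sexticDeriv x) x :=
  hasDerivAt_tsum_mul_pow abs_sexticCoeff_le_one hx

/-- The coefficients of `x (1 - x) F'(x)` for `F(x) = ₂F₁(1/6, 5/6; 1; x)`. -/
noncomputable def sexticFluxCoeff : ℕ → ℝ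
  | 0 => 0
  | k + 1 => 5 / 36 * sexticCoeff k / (k + 1)

lemma abs_sexticFluxCoeff_le_one (k : ℕ) : |sexticFluxCoeff k| ≤ 1 := by
  cases k with
  | zero => simp [sexticFluxCoeff]
  | succ k =>
    have h0 := sexticCoeff_nonneg k
    have h1 := sexticCoeff_le_one k
    rw [sexticFluxCoeff, abs_of_nonneg (by positivity), div_le_one (by positivity)]
    linarith [(Nat.cast_nonneg k : (0 : ℝ) ≤ k)]

lemma summable_mul_pow_of_abs_le {c : ℕ → ℝ} {C : ℝ} (hc : ∀ k, |c k| ≤ C) {x : ℝ}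
    (hx : |x| < 1) : Summable fun k ↦ c k * x ^ k := by
  refine ((summable_geometric_of_lt_one (abs_nonneg x) hx).mul_left C).of_norm_bounded
    fun k ↦ ?_
  rw [norm_mul, norm_pow, Real.norm_eq_abs, Real.norm_eq_abs]
  gcongr
  exact hc k

lemma mul_sexticDeriv_eq_tsum {x : ℝ} (hx : |x| < 1) :
    x * (1 - x) * sexticDeriv x = ∑' k, sexticFluxCoeff k * x ^ k := by
  have hs : Summable fun k : ℕ ↦ (k + 1) * sexticCoeff (k + 1) * x ^ k := by
    have hx' : ‖|x|‖ < 1 := by simpa using hx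
    refine ((summable_pow_mul_geometric_of_norm_lt_one 1 hx').add
      (summable_geometric_of_norm_lt_one hx')).of_norm_bounded fun k ↦ ?_
    rw [norm_mul, norm_pow, Real.norm_eq_abs, Real.norm_eq_abs, pow_one, ← add_one_mul]
    gcongr
    rw [abs_of_nonneg (mul_nonneg (by positivity) (sexticCoeff_nonneg _))]
    exact mul_le_of_le_one_right (by positivity) (sexticCoeff_le_one _)
  have hs1 := (summable_nat_add_iff 1).mpr hs
  have hg := (summable_nat_add_iff 1).mpr (summable_mul_pow_of_abs_le abs_sexticFluxCoeff_le_one hx)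
  have h1 : (1 - x) * sexticDeriv x = sexticCoeff 1 +
      ∑' k : ℕ, 5 / 36 * sexticCoeff (k + 1) / (k + 2) * x ^ (k + 1) := by
    have hx1 : x * sexticDeriv x = ∑' k : ℕ, (k + 1) * sexticCoeff (k + 1) * x ^ (k + 1) := by
      rw [sexticDeriv, ← tsum_mul_left]
      exact tsum_congr fun k ↦ by ring
    have hs' : Summable fun k : ℕ ↦ (k + 1) * sexticCoeff (k + 1) * x ^ (k + 1) :=
      (hs.mul_left x).congr fun k ↦ by ring
    rw [sub_mul, one_mul, hx1, sexticDeriv, hs.tsum_eq_zero_add, add_sub_assoc,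
      ← hs1.tsum_sub hs']
    congr 1
    · simp
    · refine tsum_congr fun k ↦ ?_
      rw [sexticCoeff_succ (k + 1)]
      push_cast
      field_simp
      ring
  rw [mul_assoc, h1, (summable_mul_pow_of_abs_le abs_sexticFluxCoeff_le_one hx).tsum_eq_zero_add,
    hg.tsum_eq_zero_add, mul_add, ← tsum_mul_left]
  simp only [sexticFluxCoeff, sexticCoeff_succ 0, sexticCoeff_zero]
  norm_num
  congr 1
  · ring
  · refine tsum_congr fun k ↦ ?_
    ring

/-- The hypergeometric equation in self-adjoint form. -/
lemma hasDerivAt_mul_sexticDeriv {x : ℝ} (hx : |x| < 1) :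
    HasDerivAt (fun y ↦ y * (1 - y) * sexticDeriv y)
      (5 / 36 * gauss2F1 (1 / 6) (5 / 6) x) x := by
  have h := hasDerivAt_tsum_mul_pow abs_sexticFluxCoeff_le_one hx
  refine (h.congr_deriv ?_).congr_of_eventuallyEq ?_
  · rw [gauss2F1_eq_tsum_sexticCoeff, ← tsum_mul_left]
    refine tsum_congr fun k ↦ ?_
    rw [sexticFluxCoeff]
    field_simp
  · filter_upwards [(continuous_abs.tendsto x).eventually_lt_const hx] with y hy
    exact mul_sexticDeriv_eq_tsum hy

lemma gauss2F1_zero (α β : ℝ) : gauss2F1 α β 0 = 1 := by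
  rw [gauss2F1, tsum_eq_single 0 fun k hk ↦ by simp [hk]]
  simp

end HypergeometricEquation

section Inversion

open Filter Topology

lemma eq_of_hasDerivAt_zero_of_tendsto {f : ℝ → ℝ} {a c : ℝ}
    (hf : ∀ t, a ≤ t → HasDerivAt f 0 t) (hc : Tendsto f atTop (𝓝 c)) {t : ℝ} (ht : a ≤ t) :
    f t = c := by
  refine (tendsto_nhds_unique hc (tendsto_const_nhds.congr' ?_)).symm
  filter_upwards [eventually_ge_atTop t] with s hs
  refine (constant_of_has_deriv_right_zero (a := t) (b := s)
    (fun y hy ↦ (hf y (ht.trans hy.1)).continuousAt.continuousWithinAt)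
    (fun y hy ↦ (hf y (ht.trans hy.1)).hasDerivWithinAt) s ⟨hs, le_rfl⟩).symm

/-- The fourth root of `E₄(it)`. -/
noncomputable def E4root (t : ℝ) : ℝ := E4val t ^ ((1 : ℝ) / 4)

lemma E4val_pos (t : ℝ) : 0 < E4val t := one_pos.trans_le (one_le_E4val t)

lemma E4root_pos (t : ℝ) : 0 < E4root t := Real.rpow_pos_of_pos (E4val_pos t) _

lemma E4root_pow_four (t : ℝ) : E4root t ^ 4 = E4val t := by
  rw [E4root, ← Real.rpow_mul_natCast (E4val_pos t).le]
  norm_num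

lemma xval_eq (t : ℝ) : xval t = 1 / 2 * (1 - E6val t / E4root t ^ 6) := by
  rw [xval, E4root, ← Real.rpow_mul_natCast (E4val_pos t).le]
  norm_num

lemma hasDerivAt_E4root {t : ℝ} (ht : 0 < t) :
    HasDerivAt E4root (-(2 * Real.pi) *
      ((E2val t * E4root t ^ 4 - E6val t) / (12 * E4root t ^ 3))) t := by
  refine ((hasDerivAt_E4val ht).rpow_const (p := 1 / 4) (.inl (E4val_pos t).ne')).congr_deriv ?_
  have h : E4val t ^ ((1 : ℝ) / 4 - 1) = (E4root t ^ 3)⁻¹ := by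
    rw [E4root, ← Real.rpow_mul_natCast (E4val_pos t).le, ← Real.rpow_neg (E4val_pos t).le]
    norm_num
  have := (E4root_pos t).ne'
  rw [h, E4root_pow_four]
  field_simp
  ring

lemma hasDerivAt_xval {t : ℝ} (ht : 0 < t) :
    HasDerivAt xval (-(2 * Real.pi) * (xval t * (1 - xval t) * E4root t ^ 2)) t := by
  have hu := (E4root_pos t).ne'
  have h := (((hasDerivAt_E6val ht).div ((hasDerivAt_E4root ht).pow 6)
    (pow_ne_zero 6 hu)).const_sub 1).const_mul (1 / 2)
  rw [funext xval_eq]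
  refine h.congr_deriv ?_
  simp only [Pi.pow_apply]
  rw [← E4root_pow_four]
  field_simp
  ring

lemma xval_mem_Icc {t : ℝ} (ht : 1 ≤ t) : xval t ∈ Set.Icc (0 : ℝ) (1 / 2) := by
  have h1 : 1 ≤ E4val t ^ ((3 : ℝ) / 2) := Real.one_le_rpow (one_le_E4val t) (by norm_num)
  have h2 : E6val t / E4val t ^ ((3 : ℝ) / 2) ≤ 1 :=
    (div_le_one (by linarith)).mpr ((E6val_le_one t).trans h1)
  have h3 : 0 ≤ E6val t / E4val t ^ ((3 : ℝ) / 2) := div_nonneg (E6val_nonneg ht) (by linarith)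
  rw [xval]
  constructor <;> linarith

lemma abs_xval_lt_one {t : ℝ} (ht : 1 ≤ t) : |xval t| < 1 := by
  obtain ⟨h0, h1⟩ := xval_mem_Icc ht
  rw [abs_of_nonneg h0]
  linarith

lemma tendsto_E4root : Tendsto E4root atTop (𝓝 1) := by
  have := tendsto_E4val.rpow_const (p := 1 / 4) (.inl one_ne_zero)
  rwa [Real.one_rpow] at this

lemma tendsto_xval : Tendsto xval atTop (𝓝 0) := by
  have := ((tendsto_E6val.div (tendsto_E4val.rpow_const (p := 3 / 2) (.inl one_ne_zero))
    (by simp)).const_sub 1).const_mul (1 / 2)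
  rwa [Real.one_rpow, div_one, sub_self, mul_zero] at this

lemma tendsto_gauss2F1_xval :
    Tendsto (fun t ↦ gauss2F1 (1 / 6) (5 / 6) (xval t)) atTop (𝓝 1) := by
  have h := (hasDerivAt_gauss2F1_sextic (x := 0) (by simp)).continuousAt.tendsto
  rw [gauss2F1_zero] at h
  exact h.comp tendsto_xval

/-- `D u / u²` for `u` the fourth root of `E₄(it)`. -/
noncomputable def E4rootLogDeriv (t : ℝ) : ℝ :=
  (E2val t - E6val t / E4root t ^ 4) / (12 * E4root t)

lemma hasDerivAt_E4rootLogDeriv {t : ℝ} (ht : 0 < t) :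
    HasDerivAt E4rootLogDeriv
      (-(2 * Real.pi) * (5 / 36 * (xval t * (1 - xval t) * E4root t ^ 3))) t := by
  have hu := (E4root_pos t).ne'
  have h := ((hasDerivAt_E2val ht).sub ((hasDerivAt_E6val ht).div ((hasDerivAt_E4root ht).pow 4)
    (pow_ne_zero 4 hu))).div ((hasDerivAt_E4root ht).const_mul 12) (mul_ne_zero (by norm_num) hu)
  refine h.congr_deriv ?_
  simp only [Pi.pow_apply, Pi.sub_apply, Pi.div_apply, xval_eq]
  rw [← E4root_pow_four]
  field_simp
  ring

/-- The Wronskian of the hypergeometric function and the fourth root of `E₄` vanishes. -/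
lemma wronskian_eq_zero {t : ℝ} (ht : 1 ≤ t) :
    xval t * (1 - xval t) * sexticDeriv (xval t) * E4root t -
      gauss2F1 (1 / 6) (5 / 6) (xval t) * E4rootLogDeriv t = 0 := by
  refine eq_of_hasDerivAt_zero_of_tendsto (f := fun t ↦
    xval t * (1 - xval t) * sexticDeriv (xval t) * E4root t -
      gauss2F1 (1 / 6) (5 / 6) (xval t) * E4rootLogDeriv t) (fun s hs ↦ ?_) ?_ ht
  · have hs0 : 0 < s := one_pos.trans_le hs
    have hx := hasDerivAt_xval hs0
    have hG := (hasDerivAt_mul_sexticDeriv (abs_xval_lt_one hs)).comp s hx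
    have hF := (hasDerivAt_gauss2F1_sextic (abs_xval_lt_one hs)).comp s hx
    have h := (hG.mul (hasDerivAt_E4root hs0)).sub (hF.mul (hasDerivAt_E4rootLogDeriv hs0))
    refine h.congr_deriv ?_
    have hu := (E4root_pos s).ne'
    simp only [Function.comp_apply, E4rootLogDeriv]
    field_simp
    ring
  · have h := (hasDerivAt_mul_sexticDeriv (x := 0) (by simp)).continuousAt.tendsto.comp
      tendsto_xval
    have hV : Tendsto E4rootLogDeriv atTop (𝓝 0) := by
      simpa using! (tendsto_E2val.sub (tendsto_E6val.div (tendsto_E4root.pow 4) (by simp))).div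
        (tendsto_E4root.const_mul 12) (by simp)
    simpa using (h.mul tendsto_E4root).sub (tendsto_gauss2F1_xval.mul hV)

lemma gauss2F1_xval {t : ℝ} (ht : 1 ≤ t) : gauss2F1 (1 / 6) (5 / 6) (xval t) = E4root t := by
  refine (div_eq_one_iff_eq (E4root_pos t).ne').mp (eq_of_hasDerivAt_zero_of_tendsto
    (f := fun t ↦ gauss2F1 (1 / 6) (5 / 6) (xval t) / E4root t) (fun s hs ↦ ?_) ?_ ht)
  · have hs0 : 0 < s := one_pos.trans_le hs
    have hF := (hasDerivAt_gauss2F1_sextic (abs_xval_lt_one hs)).comp s (hasDerivAt_xval hs0)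
    have hu := (E4root_pos s).ne'
    refine (hF.div (hasDerivAt_E4root hs0) hu).congr_deriv ?_
    have hW := wronskian_eq_zero hs
    rw [E4rootLogDeriv] at hW
    simp only [Function.comp_apply]
    field_simp at hW ⊢
    linear_combination -(2 * Real.pi) * hW
  · simpa using! tendsto_gauss2F1_xval.div tendsto_E4root one_ne_zero

end Inversion

/-- For `t ≥ 1`, `x(t) ∈ [0, 1/2]` and `₂F₁(1/6, 5/6; 1; x(t)) = E4(it)^{1/4}`. -/
theorem statement17 :
    ∀ t : ℝ, 1 ≤ t →
      xval t ∈ Set.Icc (0 : ℝ) (1 / 2) ∧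
      gauss2F1 (1 / 6) (5 / 6) (xval t) = E4val t ^ ((1 : ℝ) / 4) :=
  fun _ ht ↦ ⟨xval_mem_Icc ht, gauss2F1_xval ht⟩
end
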